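/- Let AB and CD be distinct oriented prime segments such that f_AB(C) = 1, f_AB(D) = 0, and f_CD(A) = 1. Then f_CD(B) = 1, the points B, C, D are not collinear, and A lies in the (closed) triangle BCD. -/

import Mathlib

/-- Cast an integer point to the real plane. -/
def toR (p : ℤ × ℤ) : ℝ × ℝ := ((p.1 : ℝ), (p.2 : ℝ))

/-- Signed area determinant Δ(P,Q,R). -/
def Det (P Q R : ℤ × ℤ) : ℤ :=
  (Q.1 - P.1) * (R.2 - P.2) - (Q.2 - P.2) * (R.1 - P.1)

/-- Two integer points are adjacent: distinct, and the segment between them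
contains no integer point other than the endpoints. -/
def Adjacent (A B : ℤ × ℤ) : Prop :=
  A ≠ B ∧ ∀ C : ℤ × ℤ, toR C ∈ segment ℝ (toR A) (toR B) → C = A ∨ C = B

/-- The {0,1}-valued (Bool-valued) function defined by the oriented prime
segment AB: on the line through A and B it is true iff the point is strictly
closer to A than to B; off the line it is true iff triangle A B X is
counterclockwise. -/
def fseg (A B X : ℤ × ℤ) : Bool :=
  if Det A B X = 0 then
    decide ((X.1 - A.1) ^ 2 + (X.2 - A.2) ^ 2 < (X.1 - B.1) ^ 2 + (X.2 - B.2) ^ 2)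
  else
    decide (0 < Det A B X)

/-- The grid {0,…,m−1} × {0,…,n−1} as a set of integer points. -/
def Grid (m n : ℕ) : Set (ℤ × ℤ) :=
  {p | 0 ≤ p.1 ∧ p.1 < (m : ℤ) ∧ 0 ≤ p.2 ∧ p.2 < (n : ℤ)}

/-- A pair of oriented prime segments (A,B), (C,D) is proper. -/
def ProperPair (A B C D : ℤ × ℤ) : Prop :=
  Adjacent A B ∧ Adjacent C D ∧
    fseg C D A = true ∧ fseg C D B = true ∧ fseg A B C = true ∧ fseg A B D = true

/-- f is a threshold function on the grid. -/
def IsThreshold (m n : ℕ) (f : ℤ × ℤ → Bool) : Prop :=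
  ∃ a0 a1 a2 : ℝ, ∀ p ∈ Grid m n,
    (f p = true ↔ a1 * (p.1 : ℝ) + a2 * (p.2 : ℝ) ≥ a0)

/-- f is a 2-threshold function on the grid: a conjunction of two threshold
functions. -/
def Is2Threshold (m n : ℕ) (f : ℤ × ℤ → Bool) : Prop :=
  ∃ g h : ℤ × ℤ → Bool, IsThreshold m n g ∧ IsThreshold m n h ∧
    ∀ p ∈ Grid m n, f p = (g p && h p)

theorem Det_nonneg_of_fseg {A B X : ℤ × ℤ} (h : fseg A B X = true) : 0 ≤ Det A B X := by
  unfold fseg at h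
  split_ifs at h with h0
  · exact h0.ge
  · exact (of_decide_eq_true h).le

theorem Det_nonpos_of_fseg {A B X : ℤ × ℤ} (h : fseg A B X = false) : Det A B X ≤ 0 := by
  unfold fseg at h
  split_ifs at h with h0
  · exact h0.le
  · exact not_lt.mp (of_decide_eq_false h)

theorem fseg_of_Det_pos {A B X : ℤ × ℤ} (h : 0 < Det A B X) : fseg A B X = true := by
  simp [fseg, h.ne', h]

theorem exists_param_of_Det_eq_zero {A B X : ℤ × ℤ} (hAB : A ≠ B) (h : Det A B X = 0) :
    ∃ s : ℝ, (X.1 : ℝ) - A.1 = s * (B.1 - A.1) ∧ (X.2 : ℝ) - A.2 = s * (B.2 - A.2) := by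
  have hR : ((B.1 : ℝ) - A.1) * (X.2 - A.2) - (B.2 - A.2) * (X.1 - A.1) = 0 := by
    exact_mod_cast h
  by_cases h1 : B.1 = A.1
  · have h2 : (B.2 : ℝ) - A.2 ≠ 0 := by
      refine sub_ne_zero.mpr fun h2 => hAB (Prod.ext h1.symm ?_)
      exact_mod_cast h2.symm
    refine ⟨(X.2 - A.2) / (B.2 - A.2), ?_, ?_⟩
    · field_simp
      linarith
    · field_simp
  · have h2 : (B.1 : ℝ) - A.1 ≠ 0 := by
      refine sub_ne_zero.mpr fun h2 => h1 ?_
      exact_mod_cast h2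
    refine ⟨(X.1 - A.1) / (B.1 - A.1), ?_, ?_⟩
    · field_simp
    · field_simp
      linarith

theorem Adjacent.eq_or_eq {A B X : ℤ × ℤ} (h : Adjacent A B) {s : ℝ} (hs0 : 0 ≤ s) (hs1 : s ≤ 1)
    (h1 : (X.1 : ℝ) - A.1 = s * (B.1 - A.1)) (h2 : (X.2 : ℝ) - A.2 = s * (B.2 - A.2)) :
    X = A ∨ X = B := by
  refine h.2 X ⟨1 - s, s, by linarith, hs0, by ring, ?_⟩
  ext
  · simp [toR]
    linarith
  · simp [toR]
    linarith

theorem eq_of_fseg_of_Det_eq_zero {A B C D : ℤ × ℤ} (hAB : Adjacent A B) (hCD : Adjacent C D)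
    (h1 : fseg A B C = true) (h2 : fseg A B D = false)
    (hC : Det A B C = 0) (hD : Det A B D = 0) : (A, B) = (C, D) := by
  obtain ⟨s, hs1, hs2⟩ := exists_param_of_Det_eq_zero hAB.1 hC
  obtain ⟨t, ht1, ht2⟩ := exists_param_of_Det_eq_zero hAB.1 hD
  simp only [fseg, hC, hD, if_true, decide_eq_true_eq, decide_eq_false_iff_not, not_lt] at h1 h2
  have h1R : ((C.1 : ℝ) - A.1) ^ 2 + (C.2 - A.2) ^ 2 < (C.1 - B.1) ^ 2 + (C.2 - B.2) ^ 2 := by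
    exact_mod_cast h1
  have h2R : ((D.1 : ℝ) - B.1) ^ 2 + (D.2 - B.2) ^ 2 ≤ (D.1 - A.1) ^ 2 + (D.2 - A.2) ^ 2 := by
    exact_mod_cast h2
  set n : ℝ := ((B.1 : ℝ) - A.1) ^ 2 + (B.2 - A.2) ^ 2 with hn
  have hsn : 0 < (1 - 2 * s) * n := by
    have e1 : (C.1 : ℝ) - B.1 = (s - 1) * (B.1 - A.1) := by linarith
    have e2 : (C.2 : ℝ) - B.2 = (s - 1) * (B.2 - A.2) := by linarith
    rw [hs1, hs2, e1, e2] at h1R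
    linear_combination h1R
  have htn : (1 - 2 * t) * n ≤ 0 := by
    have e1 : (D.1 : ℝ) - B.1 = (t - 1) * (B.1 - A.1) := by linarith
    have e2 : (D.2 : ℝ) - B.2 = (t - 1) * (B.2 - A.2) := by linarith
    rw [ht1, ht2, e1, e2] at h2R
    linear_combination h2R
  have hn0 : 0 < n := lt_of_le_of_ne (by positivity) fun h => by simp [← h] at hsn
  have hs : s < 1 / 2 := by linarith [pos_of_mul_pos_left hsn hn0.le]
  have ht : 1 / 2 ≤ t := by linarith [nonpos_of_mul_nonpos_left htn hn0]
  have hCB : C ≠ B := by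
    rintro rfl
    linarith [sq_nonneg (C.1 - A.1), sq_nonneg (C.2 - A.2)]
  have hDA : D ≠ A := by
    rintro rfl
    simp only [sub_self] at h2R
    linarith [sq_nonneg ((B.1 : ℝ) - D.1), show n ≤ 0 by linarith]
  have hCA : C = A := by
    rcases le_total s 0 with hs0 | hs0
    · have hts : 0 < t - s := by linarith
      have key := hCD.eq_or_eq (X := A) (s := -s / (t - s)) (by apply div_nonneg <;> linarith)
        (by rw [div_le_one hts]; linarith)
        (by
          rw [show (D.1 : ℝ) - C.1 = (t - s) * (B.1 - A.1) by linarith]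
          field_simp
          linarith)
        (by
          rw [show (D.2 : ℝ) - C.2 = (t - s) * (B.2 - A.2) by linarith]
          field_simp
          linarith)
      exact (key.resolve_right hDA.symm).symm
    · exact (hAB.eq_or_eq hs0 (by linarith) hs1 hs2).resolve_right hCB
  subst hCA
  have hDB : D = B := by
    rcases le_total t 1 with ht0 | ht0
    · exact (hAB.eq_or_eq (by linarith) ht0 ht1 ht2).resolve_left hDA
    · have htp : 0 < t := by linarith
      refine ((hCD.eq_or_eq (X := B) (s := 1 / t) (by positivity)
        (by rw [div_le_one htp]; exact ht0) ?_ ?_).resolve_left hAB.1.symm).symm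
      · rw [ht1]
        field_simp
      · rw [ht2]
        field_simp
  rw [hDB]

theorem Det_eq_zero_of_collinear {P Q R : ℤ × ℤ}
    (h : Collinear ℝ ({toR P, toR Q, toR R} : Set (ℝ × ℝ))) : Det P Q R = 0 := by
  rw [collinear_iff_of_mem (p₀ := toR P) (by simp)] at h
  obtain ⟨v, hv⟩ := h
  obtain ⟨q, hq⟩ := hv (toR Q) (by simp)
  obtain ⟨r, hr⟩ := hv (toR R) (by simp)
  simp only [toR, Prod.ext_iff, vadd_eq_add, Prod.fst_add, Prod.snd_add, Prod.smul_fst,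
    Prod.smul_snd, smul_eq_mul] at hq hr
  have : ((Det P Q R : ℤ) : ℝ) = 0 := by
    simp only [Det]
    push_cast
    rw [hq.1, hq.2, hr.1, hr.2]
    ring
  exact_mod_cast this

theorem mem_convexHull_triple_of_Det {P Q R X : ℤ × ℤ} (hS : 0 < Det Q R P)
    (hP : 0 ≤ Det Q R X) (hQ : 0 ≤ Det R P X) (hR : 0 ≤ Det P Q X) :
    toR X ∈ convexHull ℝ ({toR P, toR Q, toR R} : Set (ℝ × ℝ)) := by
  have hS' : (0 : ℝ) < Det Q R P := by exact_mod_cast hS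
  have hsum : (Det Q R X : ℝ) + Det R P X + Det P Q X = Det Q R P := by
    simp only [Det]
    push_cast
    ring
  have hmem := (convex_convexHull ℝ ({toR P, toR Q, toR R} : Set (ℝ × ℝ))).sum_mem
    (t := Finset.univ) (w := ![(Det Q R X : ℝ) / Det Q R P, Det R P X / Det Q R P,
      Det P Q X / Det Q R P]) (z := ![toR P, toR Q, toR R])
    (by
      intro i _
      fin_cases i
      · exact div_nonneg (by exact_mod_cast hP) hS'.le
      · exact div_nonneg (by exact_mod_cast hQ) hS'.le
      · exact div_nonneg (by exact_mod_cast hR) hS'.le)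
    (by
      simp only [Fin.sum_univ_three, Matrix.cons_val]
      field_simp
      exact hsum)
    (by
      intro i _
      fin_cases i <;> exact subset_convexHull ℝ _ (by simp))
  convert hmem using 1
  simp only [Fin.sum_univ_three, Matrix.cons_val]
  ext
  · simp only [toR, Prod.fst_add, Prod.smul_fst, smul_eq_mul]
    field_simp
    simp only [Det]
    push_cast
    ring
  · simp only [toR, Prod.snd_add, Prod.smul_snd, smul_eq_mul]
    field_simp
    simp only [Det]
    push_cast
    ring

/-- for distinct oriented prime segments AB, CD with
f_AB(C)=1, f_AB(D)=0, f_CD(A)=1, we get f_CD(B)=1, the points B, C, D are not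
collinear, and A lies in the closed triangle BCD. -/
theorem stmt16 (A B C D : ℤ × ℤ)
    (hAB : Adjacent A B) (hCD : Adjacent C D) (hne : (A, B) ≠ (C, D))
    (h1 : fseg A B C = true) (h2 : fseg A B D = false) (h3 : fseg C D A = true) :
    fseg C D B = true ∧
    ¬ Collinear ℝ ({toR B, toR C, toR D} : Set (ℝ × ℝ)) ∧
    toR A ∈ convexHull ℝ ({toR B, toR C, toR D} : Set (ℝ × ℝ)) := by
  have hC := Det_nonneg_of_fseg h1
  have hD := Det_nonpos_of_fseg h2
  have hA := Det_nonneg_of_fseg h3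
  have hsum : Det C D B = Det C D A + Det A B C - Det A B D := by
    simp only [Det]
    ring
  have hS : 0 < Det C D B := by
    by_contra hS
    exact hne (eq_of_fseg_of_Det_eq_zero hAB hCD h1 h2 (by lia) (by lia))
  have hBCD : Det B C D = Det C D B := by
    simp only [Det]
    ring
  have hDBA : Det D B A = -Det A B D := by
    simp only [Det]
    ring
  have hBCA : Det B C A = Det A B C := by
    simp only [Det]
    ring
  refine ⟨fseg_of_Det_pos hS, fun h => ?_, ?_⟩
  · have := Det_eq_zero_of_collinear h
    lia
  · exact mem_convexHull_triple_of_Det hS hA (by lia) (by lia)
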